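/- Let c > 1 be a non-integer real number and p(t) = t^c. Then the series ∑_{n=1}^∞ e^{2πi p(n)}/n converges (conditionally) in ℂ. -/

import Mathlib

open Finset Filter

noncomputable def oee (x : ℝ) : ℂ := Complex.exp (2 * Real.pi * Complex.I * (x : ℝ))

lemma oee_norm (x : ℝ) : ‖oee x‖ = 1 := by
  have : oee x = Complex.exp (((2 * Real.pi * x : ℝ) : ℂ) * Complex.I) := by
    unfold oee; congr 1; push_cast; ring
  rw [this, Complex.norm_exp_ofReal_mul_I]

lemma oee_add (x y : ℝ) : oee (x + y) = oee x * oee y := by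
  unfold oee; rw [← Complex.exp_add]; congr 1; push_cast; ring

lemma oee_sub (x y : ℝ) : oee (x - y) = oee x * (starRingEnd ℂ) (oee y) := by
  have h1 : oee x = oee (x - y) * oee y := by rw [← oee_add]; congr 1; ring
  have h2 : oee y * (starRingEnd ℂ) (oee y) = 1 := by
    rw [Complex.mul_conj, Complex.normSq_eq_norm_sq, oee_norm]; simp
  rw [h1, mul_assoc, h2, mul_one]

lemma oee_u (d : ℝ) (hs : Real.sin (Real.pi * d) ≠ 0) :
    (oee d - 1) * (-1/2 - Complex.I / 2 *
      ((Real.cos (Real.pi * d) / Real.sin (Real.pi * d) : ℝ) : ℂ)) = 1 := by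
  have h : oee d = (Complex.cos (Real.pi * d) + Complex.sin (Real.pi * d) * Complex.I)^2 := by
    rw [← Complex.exp_mul_I, ← Complex.exp_nat_mul]; unfold oee; congr 1; push_cast; ring
  have hs' : Complex.sin (Real.pi * d) ≠ 0 := by exact_mod_cast hs
  have h3 := Complex.sin_sq_add_cos_sq (Real.pi * d)
  rw [h]
  push_cast
  generalize Complex.sin (Real.pi * d) = s at *
  generalize Complex.cos (Real.pi * d) = k at *
  field_simp
  have hI : Complex.I ^ 2 = -1 := Complex.I_sq
  have hk : k ^ 2 = 1 - s^2 := by linear_combination h3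
  generalize Complex.I = i at *
  grind

def OGood : ℕ → (ℕ → ℝ) → ℕ → ℝ → ℝ → Prop
  | 0, F, N, A, B => (∀ n < N, A ≤ F n ∧ F n ≤ B) ∧ ∀ n, n + 1 < N → F (n+1) ≤ F n
  | k+1, F, N, A, B => ∀ h : ℕ, 1 ≤ h →
      OGood k (fun n => F (n + h) - F n) (N - h) (h * A) (h * B)

lemma OGood.mono {k : ℕ} : ∀ {F : ℕ → ℝ} {N : ℕ} {A B A' B' : ℝ}, OGood k F N A B → A' ≤ A → B ≤ B' →
    OGood k F N A' B' := by
  induction k with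
  | zero =>
    intro F N A B A' B' h hA hB
    exact ⟨fun n hn => ⟨hA.trans (h.1 n hn).1, (h.1 n hn).2.trans hB⟩, h.2⟩
  | succ k ih =>
    intro F N A B A' B' h hA hB m hm
    exact ih (h m hm) (by gcongr) (by gcongr)

/-- Kuzmin-Landau -/
lemma okl (F : ℕ → ℝ) (N : ℕ) (A B : ℝ) (hA : 0 < A) (hB : B ≤ 1/2)
    (hF : OGood 1 F N A B) : ‖∑ n ∈ range N, oee (F n)‖ ≤ 2 + 1 / A := by
  have h1 := hF 1 le_rfl
  simp only [OGood, Nat.cast_one, one_mul] at h1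
  obtain ⟨h1, h2⟩ := h1
  set d : ℕ → ℝ := fun n => F (n+1) - F n with hd
  set c : ℕ → ℝ := fun n => Real.cos (Real.pi * d n) / Real.sin (Real.pi * d n) with hcdef
  set u : ℕ → ℂ := fun n => -1/2 - Complex.I / 2 * (c n : ℂ) with hu
  have hpi := Real.pi_pos
  have hsin : ∀ n < N - 1, 0 < Real.sin (Real.pi * d n) := by
    intro n hn
    have := h1 n hn
    apply Real.sin_pos_of_pos_of_lt_pi
    · have : 0 < d n := by simp only [hd]; linarith
      positivity
    · have : d n ≤ 1/2 := by simp only [hd]; linarith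
      nlinarith
  have hc0 : ∀ n < N - 1, 0 ≤ c n := by
    intro n hn
    have := h1 n hn
    have h0 : 0 < d n := by simp only [hd]; linarith
    have h0' : d n ≤ 1/2 := by simp only [hd]; linarith
    apply div_nonneg _ (hsin n hn).le
    apply Real.cos_nonneg_of_neg_pi_div_two_le_of_le
    · have : 0 < Real.pi * d n := by positivity
      linarith
    · nlinarith
  have hc1 : ∀ n < N - 1, c n ≤ 1 / A := by
    intro n hn
    have := h1 n hn
    have h0 : A ≤ d n := by simp only [hd]; linarith
    have h0' : d n ≤ 1/2 := by simp only [hd]; linarith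
    have h3 : 2 / Real.pi * (Real.pi * d n) ≤ Real.sin (Real.pi * d n) := by
      apply Real.mul_le_sin
      · have : 0 < d n := by linarith
        positivity
      · nlinarith
    have h4 : 2 / Real.pi * (Real.pi * d n) = 2 * d n := by field_simp
    have h5 : A ≤ Real.sin (Real.pi * d n) := by linarith
    exact div_le_div₀ zero_le_one (Real.cos_le_one _) hA h5
  have hcm : ∀ n, n + 1 < N - 1 → c n ≤ c (n+1) := by
    intro n hn
    have ha := h1 n (by omega)
    have hb := h1 (n+1) hn
    have hab := h2 n hn
    simp only [hcdef]
    rw [div_le_div_iff₀ (hsin n (by omega)) (hsin (n+1) hn)]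
    have : 0 ≤ Real.sin (Real.pi * d n - Real.pi * d (n+1)) := by
      apply Real.sin_nonneg_of_nonneg_of_le_pi
      · have : 0 ≤ d n - d (n+1) := by simp only [hd]; linarith
        rw [← mul_sub]; positivity
      · have : d n - d (n+1) ≤ 1 := by simp only [hd]; linarith
        rw [← mul_sub]; nlinarith
    rw [Real.sin_sub] at this
    linarith
  have hun : ∀ n < N - 1, ‖u n‖ ≤ 1/2 + 1/2 * c n := by
    intro n hn
    simp only [hu]
    refine (norm_sub_le _ _).trans ?_
    simp [abs_of_nonneg (hc0 n hn)]
  have hz : ∀ n < N - 1, oee (F n) = (oee (F (n+1)) - oee (F n)) * u n := by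
    intro n hn
    have e := oee_u (d n) (hsin n hn).ne'
    have e2 : oee (F (n+1)) = oee (F n) * oee (d n) := by
      rw [← oee_add]; congr 1; simp only [hd]; ring
    rw [e2]
    simp only [hu, hcdef]
    linear_combination (-oee (F n)) * e
  have key : ∀ m, m < N - 1 → ‖∑ n ∈ range (m+1), oee (F n) - oee (F (m+1)) * u m‖ ≤
      1/2 + 1/2 * c 0 + 1/2 * (c m - c 0) := by
    intro m
    induction m with
    | zero =>
      intro hm
      have e := hz 0 hm
      have : ∑ n ∈ range (0+1), oee (F n) - oee (F (0+1)) * u 0 = - (oee (F 0) * u 0) := by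
        rw [zero_add, sum_range_one]
        rw [zero_add] at e
        linear_combination e
      rw [this, norm_neg, norm_mul, oee_norm]
      linarith [hun 0 hm]
    | succ m ih =>
      intro hm
      have e := hz (m+1) hm
      have : ∑ n ∈ range (m+1+1), oee (F n) - oee (F (m+1+1)) * u (m+1) =
          (∑ n ∈ range (m+1), oee (F n) - oee (F (m+1)) * u m) + oee (F (m+1)) * (u m - u (m+1)) := by
        rw [sum_range_succ _ (m+1)]
        linear_combination e
      rw [this]
      refine (norm_add_le _ _).trans ?_
      rw [norm_mul, oee_norm]
      have e3 : u m - u (m+1) = Complex.I / 2 * ((c (m+1) - c m : ℝ) : ℂ) := by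
        simp only [hu]; push_cast; ring
      have e4 : ‖u m - u (m+1)‖ = 1/2 * (c (m+1) - c m) := by
        rw [e3, norm_mul, Complex.norm_real, Real.norm_of_nonneg (by linarith [hcm m hm])]
        simp
      rw [e4]
      linarith [ih (by omega)]
  have hA' : 0 < 1 / A := by positivity
  rcases N with _ | _ | m
  · simp; positivity
  · simp [oee_norm]
    have : 0 < A⁻¹ := by positivity
    linarith
  · have k := key m (by omega)
    have k2 := hun m (by omega)
    have k3 := hc1 m (by omega)
    rw [sum_range_succ]
    have : ∑ n ∈ range (m+1), oee (F n) + oee (F (m+1)) = (∑ n ∈ range (m+1), oee (F n) - oee (F (m+1)) * u m) + oee (F (m+1)) * u m + oee (F (m+1)) := by ring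
    rw [this]
    refine (norm_add₃_le).trans ?_
    rw [norm_mul, oee_norm]
    linarith

lemma oshift (g : ℕ → ℂ) (H L T s : ℕ) (hs : s ≤ H) (hT : H + L ≤ T + s)
    (hg : ∀ n, g n ≠ 0 → H ≤ n ∧ n < H + L) :
    ∑ m ∈ range T, g (m + s) = ∑ n ∈ range L, g (H + n) := by
  have h1 : ∑ m ∈ range T, g (m + s) = ∑ m ∈ (range L).image (fun n => H - s + n), g (m + s) := by
    symm
    apply sum_subset
    · intro x hx
      simp only [mem_image, mem_range] at hx ⊢
      omega
    · intro x _ hx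
      by_contra h
      have := hg _ h
      apply hx
      simp only [mem_image, mem_range]
      exact ⟨x + s - H, by omega, by omega⟩
  rw [h1, sum_image (by intro a _ b _ h; simp at h; exact h)]
  apply sum_congr rfl
  intro n _
  congr 1
  omega

lemma ovdc (z : ℕ → ℂ) (hz : ∀ n, ‖z n‖ ≤ 1) (N H : ℕ) (hH : 1 ≤ H) (K : ℝ) (hK : 0 ≤ K)
    (hc : ∀ d, 1 ≤ d → d < H → ‖∑ n ∈ range (N - d), z (n + d) * (starRingEnd ℂ) (z n)‖ ≤ K) :
    ‖∑ n ∈ range N, z n‖ ^ 2 ≤ (N + H) * (N / H + K) := by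
  set w : ℕ → ℂ := fun n => if H ≤ n ∧ n < H + N then z (n - H) else 0 with hw
  have hw0 : ∀ n, w n ≠ 0 → H ≤ n ∧ n < H + N := by
    intro n hn
    by_contra h
    exact hn (by simp only [hw, if_neg h])
  have hS : ∀ h < H, ∑ m ∈ range (N + H), w (m + h) = ∑ n ∈ range N, z n := by
    intro h hh
    rw [oshift w H N (N+H) h hh.le (by omega) hw0]
    apply sum_congr rfl
    intro n hn
    simp only [mem_range] at hn
    simp [hw, hn]
  have hcorr : ∀ h d, h + d < H → ∑ m ∈ range (N + H), w (m + (h + d)) * (starRingEnd ℂ) (w (m + h))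
      = ∑ n ∈ range (N - d), z (n + d) * (starRingEnd ℂ) (z n) := by
    intro h d hh
    have := oshift (fun n => w (n + d) * (starRingEnd ℂ) (w n)) H (N - d) (N + H) h (by omega) (by omega)
      (by
        intro n hn
        have a := hw0 _ (left_ne_zero_of_mul hn)
        have b := hw0 n (by
          intro h0; apply hn; simp [h0])
        omega)
    simp only [← add_assoc] at this ⊢
    rw [this]
    apply sum_congr rfl
    intro n hn
    simp only [mem_range] at hn
    have e1 : H + n < H + N := by omega
    have e2 : H + n + d < H + N := by omega
    have e3 : H ≤ H + n + d := by omega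
    have e4 : H + n + d - H = n + d := by omega
    simp only [hw, e1, e2, e3, e4, and_self, if_true, Nat.le_add_right, Nat.add_sub_cancel_left]
  have hb : ∀ h < H, ∀ h' < H, ‖∑ m ∈ range (N + H), w (m + h) * (starRingEnd ℂ) (w (m + h'))‖ ≤
      (if h = h' then (N:ℝ) else 0) + K := by
    intro h hh h' hh'
    rcases lt_trichotomy h h' with hlt | heq | hgt
    · obtain ⟨d, rfl⟩ := Nat.exists_eq_add_of_lt hlt
      have e := hcorr h (d+1) (by omega)
      have : ∑ m ∈ range (N + H), w (m + h) * (starRingEnd ℂ) (w (m + (h + d + 1))) =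
        (starRingEnd ℂ) (∑ m ∈ range (N + H), w (m + (h + (d + 1))) * (starRingEnd ℂ) (w (m + h))) := by
        rw [map_sum]
        apply sum_congr rfl
        intro m _
        simp [mul_comm, add_assoc]
      rw [this, RCLike.norm_conj, e, if_neg (by omega), zero_add]
      exact hc _ (by omega) (by omega)
    · subst heq
      have e := hcorr h 0 (by omega)
      simp only [add_zero] at e
      rw [e, if_pos rfl]
      refine (norm_sum_le _ _).trans ?_
      refine (sum_le_sum (g := fun _ => (1:ℝ)) ?_).trans ?_
      · intro n _
        rw [norm_mul, RCLike.norm_conj]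
        have := hz n
        nlinarith [norm_nonneg (z n)]
      · simp; exact hK
    · obtain ⟨d, rfl⟩ := Nat.exists_eq_add_of_lt hgt
      have e := hcorr h' (d+1) (by omega)
      rw [add_assoc h' d 1, e, if_neg (by omega), zero_add]
      exact hc _ (by omega) (by omega)
  have hHS : (H : ℂ) * ∑ n ∈ range N, z n = ∑ m ∈ range (N + H), ∑ h ∈ range H, w (m + h) := by
    rw [sum_comm, sum_congr rfl (fun h hh => hS h (mem_range.1 hh))]
    simp
  have hCS : ((H:ℝ) * ‖∑ n ∈ range N, z n‖)^2 ≤ (N + H) * ∑ m ∈ range (N+H), ‖∑ h ∈ range H, w (m + h)‖^2 := by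
    have : (H:ℝ) * ‖∑ n ∈ range N, z n‖ ≤ ∑ m ∈ range (N + H), ‖∑ h ∈ range H, w (m + h)‖ := by
      have e : (H:ℝ) * ‖∑ n ∈ range N, z n‖ = ‖(H : ℂ) * ∑ n ∈ range N, z n‖ := by simp
      rw [e, hHS]
      exact norm_sum_le _ _
    refine (pow_le_pow_left₀ (by positivity) this 2).trans ?_
    have := sq_sum_le_card_mul_sum_sq (s := range (N+H)) (f := fun m => ‖∑ h ∈ range H, w (m + h)‖)
    simpa using this
  have hsq : ∑ m ∈ range (N+H), ‖∑ h ∈ range H, w (m + h)‖^2 ≤ H * N + H^2 * K := by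
    have e : ((∑ m ∈ range (N+H), ‖∑ h ∈ range H, w (m + h)‖^2 : ℝ) : ℂ) =
        ∑ h ∈ range H, ∑ h' ∈ range H, ∑ m ∈ range (N + H), w (m + h) * (starRingEnd ℂ) (w (m + h')) := by
      push_cast
      have : ∀ m, ((‖∑ h ∈ range H, w (m + h)‖ : ℝ) : ℂ)^2 = ∑ h ∈ range H, ∑ h' ∈ range H, w (m + h) * (starRingEnd ℂ) (w (m + h')) := by
        intro m
        rw [← Complex.mul_conj', map_sum, sum_mul_sum]
      simp only [this]
      rw [sum_comm]
      apply sum_congr rfl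
      intro h _
      rw [sum_comm]
    have e2 : ∑ m ∈ range (N+H), ‖∑ h ∈ range H, w (m + h)‖^2 = ‖((∑ m ∈ range (N+H), ‖∑ h ∈ range H, w (m + h)‖^2 : ℝ) : ℂ)‖ := by
      rw [Complex.norm_real, Real.norm_of_nonneg (by positivity)]
    rw [e2, e]
    calc _ ≤ ∑ h ∈ range H, ∑ h' ∈ range H, ((if h = h' then (N:ℝ) else 0) + K) := by
          refine (norm_sum_le _ _).trans (sum_le_sum fun h hh => ?_)
          refine (norm_sum_le _ _).trans (sum_le_sum fun h' hh' => ?_)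
          exact hb h (mem_range.1 hh) h' (mem_range.1 hh')
      _ = H * N + H^2 * K := by
          simp only [sum_add_distrib, sum_ite_eq, sum_const, card_range, nsmul_eq_mul]
          rw [sum_congr rfl (g := fun _ => (N:ℝ)) (fun h hh => by rw [if_pos hh])]
          simp; ring
  have hHp : (0:ℝ) < H := by exact_mod_cast hH
  have f : ((H:ℝ) * ‖∑ n ∈ range N, z n‖)^2 ≤ (N + H) * (H * N + H^2 * K) :=
    hCS.trans (by gcongr)
  have g : ((N:ℝ) + H) * (H * N + H^2 * K) = H^2 * ((N + H) * (N / H + K)) := by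
    field_simp
  rw [g, mul_pow] at f
  exact le_of_mul_le_mul_left f (by positivity)

lemma ogood_of_family (k : ℕ) : ∀ (G : ℕ → ℝ → ℝ) (a : ℝ) (N : ℕ) (A B : ℝ), 0 < a →
    (∀ j x, 0 < x → HasDerivAt (G j) (G (j+1) x) x) →
    AntitoneOn (G k) (Set.Ioi 0) → (∀ x ∈ Set.Ico a (a + N), A ≤ G k x ∧ G k x ≤ B) →
    OGood k (fun n => G 0 (a + n)) N A B := by
  induction k with
  | zero =>
    intro G a N A B ha hG hanti hb
    refine ⟨fun n hn => hb _ ⟨by simp, ?_⟩, fun n hn => ?_⟩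
    · have : (n:ℝ) < N := by exact_mod_cast hn
      linarith
    · apply hanti
      · simp only [Set.mem_Ioi]; positivity
      · simp only [Set.mem_Ioi]; positivity
      · push_cast; linarith
  | succ k ih =>
    intro G a N A B ha hG hanti hb h hh
    have hh0 : (0:ℝ) < h := by exact_mod_cast hh
    have hG' : ∀ j x, 0 < x → HasDerivAt (fun x => G j (x + h) - G j x) (G (j+1) (x + h) - G (j+1) x) x := by
      intro j x hx
      exact ((hG j (x+h) (by positivity)).comp_add_const x h).sub (hG j x hx)
    have := ih (fun j x => G j (x + h) - G j x) a (N - h) (h * A) (h * B) ha hG' ?_ ?_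
    · convert this using 2 with n
      push_cast; ring_nf
    · apply antitoneOn_of_deriv_nonpos (convex_Ioi 0)
      · intro x hx
        exact (hG' k x hx).continuousAt.continuousWithinAt
      · intro x hx
        rw [interior_Ioi] at hx
        exact (hG' k x hx).differentiableAt.differentiableWithinAt
      · intro x hx
        rw [interior_Ioi] at hx
        rw [(hG' k x hx).deriv]
        have hx' : 0 < x := hx
        have := hanti hx (show x + h ∈ Set.Ioi (0:ℝ) by simp only [Set.mem_Ioi]; positivity) (by linarith)
        linarith
    · intro x hx
      have hhN : h < N := by
        by_contra hc
        have : N - h = 0 := by omega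
        rw [this] at hx
        simp at hx
      rw [Nat.cast_sub hhN.le] at hx
      have hx0 : 0 < x := ha.trans_le hx.1
      obtain ⟨ξ, hξ, e⟩ := exists_hasDerivAt_eq_slope (G k) (G (k+1)) (show x < x + h by linarith)
        (fun y hy => (hG k y (hx0.trans_le hy.1)).continuousAt.continuousWithinAt)
        (fun y hy => hG k y (hx0.trans hy.1))
      have e2 : G k (x + h) - G k x = h * G (k+1) ξ := by
        rw [e, add_sub_cancel_left]; field_simp
      have := hb ξ ⟨hx.1.trans hξ.1.le, by linarith [hξ.2, hx.2]⟩
      show h * A ≤ G k (x + h) - G k x ∧ G k (x + h) - G k x ≤ h * B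
      rw [e2]
      exact ⟨by gcongr; exact this.1, by gcongr; exact this.2⟩

lemma oclaim (k : ℕ) : ∀ σ η : ℝ, 0 < σ → σ < 1 → 0 < η → ∃ δ C : ℝ, ∃ M0 : ℕ, 0 < δ ∧ 0 ≤ C ∧
    ∀ M N : ℕ, M0 ≤ M → N ≤ M → ∀ F : ℕ → ℝ, OGood (k+1) F N ((M:ℝ)^(-σ)) ((M:ℝ)^(-η)) →
      ‖∑ n ∈ range N, oee (F n)‖ ≤ C * (M:ℝ)^(1-δ) := by
  induction k with
  | zero =>
    intro σ η hσ hσ1 hη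
    have ht : Tendsto (fun M : ℕ => (M:ℝ)^(-η)) atTop (nhds 0) :=
      (tendsto_rpow_neg_atTop hη).comp tendsto_natCast_atTop_atTop
    have hev := ht.eventually (Iic_mem_nhds (show (0:ℝ) < 1/2 by norm_num))
    obtain ⟨M0, hM0⟩ := eventually_atTop.1 hev
    refine ⟨1 - σ, 3, M0 + 1, by linarith, by norm_num, ?_⟩
    intro M N hM hN F hF
    have hM1 : (1:ℝ) ≤ M := by exact_mod_cast (by omega : 1 ≤ M)
    have h := okl F N _ _ (by positivity) (hM0 M (by omega)) hF
    rw [Real.rpow_neg (by positivity), one_div, inv_inv] at h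
    have : (1:ℝ) ≤ (M:ℝ)^σ := Real.one_le_rpow hM1 hσ.le
    rw [sub_sub_cancel]
    linarith
  | succ k ih =>
    intro σ η hσ hσ1 hη
    set η1 := min η 1 with hη1
    have hη1p : 0 < η1 := lt_min hη one_pos
    have hη1a : η1 ≤ η := min_le_left _ _
    have hη1b : η1 ≤ 1 := min_le_right _ _
    obtain ⟨δ', C', M0, hδ', hC', ih⟩ := ih σ (η1/2) hσ hσ1 (by positivity)
    set δ := min (η1/4) (δ'/2) with hδ
    have hδ1 : δ ≤ η1/4 := min_le_left _ _
    have hδ2 : δ ≤ δ'/2 := min_le_right _ _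
    refine ⟨δ, 4 + 2 * C', M0 + 1, lt_min (by positivity) (by positivity), by positivity, ?_⟩
    intro M N hM hN F hF
    have hM1 : (1:ℝ) ≤ M := by exact_mod_cast (by omega : 1 ≤ M)
    have hMp : (0:ℝ) < M := by linarith
    set x : ℝ := (M:ℝ)^(η1/2) with hx
    have hx1 : 1 ≤ x := Real.one_le_rpow hM1 (by positivity)
    have hxM : x ≤ M := by
      calc x ≤ (M:ℝ)^(1:ℝ) := Real.rpow_le_rpow_of_exponent_le hM1 (by linarith)
        _ = M := Real.rpow_one _
    set H := ⌊x⌋₊ with hH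
    have hH1 : 1 ≤ H := (Nat.one_le_floor_iff x).2 hx1
    have hHx : (H:ℝ) ≤ x := Nat.floor_le (by linarith)
    have hxH : x < H + 1 := Nat.lt_floor_add_one x
    have hH1' : (1:ℝ) ≤ H := by exact_mod_cast hH1
    have hNM : (N:ℝ) ≤ M := by exact_mod_cast hN
    have hv := ovdc (fun n => oee (F n)) (fun n => (oee_norm _).le) N H hH1 (C' * (M:ℝ)^(1-δ'))
      (by positivity) (by
        intro d hd hdH
        have hd1 : (1:ℝ) ≤ d := by exact_mod_cast hd
        have hdx : (d:ℝ) ≤ x := le_trans (by exact_mod_cast hdH.le) hHx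
        have := ih M (N - d) (by omega) (by omega) (fun n => F (n + d) - F n) ((hF d hd).mono ?_ ?_)
        · simpa only [oee_sub] using this
        · exact le_mul_of_one_le_left (by positivity) hd1
        · calc (d:ℝ) * (M:ℝ)^(-η) ≤ x * (M:ℝ)^(-η1) := by
                gcongr
            _ = (M:ℝ)^(-(η1/2)) := by
                rw [hx, ← Real.rpow_add hMp]; congr 1; ring)
    have e1 : (N:ℝ) / H ≤ 2 * (M:ℝ)^(1-2*δ) := by
      calc (N:ℝ)/H ≤ M / (x/2) := by
            gcongr
            linarith
        _ = 2 * (M:ℝ)^(1 - η1/2) := by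
            rw [Real.rpow_sub hMp, Real.rpow_one, ← hx]; field_simp
        _ ≤ _ := by
            gcongr 2 * ?_
            exact Real.rpow_le_rpow_of_exponent_le hM1 (by linarith)
    have e2 : (M:ℝ)^(1-δ') ≤ (M:ℝ)^(1-2*δ) := Real.rpow_le_rpow_of_exponent_le hM1 (by linarith)
    have e3 : ((M:ℝ)^(1-δ))^2 = M * (M:ℝ)^(1-2*δ) := by
      rw [← Real.rpow_natCast, ← Real.rpow_mul hMp.le]
      nth_rw 2 [← Real.rpow_one (M:ℝ)]
      rw [← Real.rpow_add hMp]; congr 1; push_cast; ring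
    have e4 : ‖∑ n ∈ range N, oee (F n)‖^2 ≤ ((4 + 2*C') * (M:ℝ)^(1-δ))^2 := by
      calc _ ≤ _ := hv
        _ ≤ (M + M) * (2 * (M:ℝ)^(1-2*δ) + C' * (M:ℝ)^(1-2*δ)) := by
            have hHM : H ≤ M := by exact_mod_cast hHx.trans hxM
            gcongr
        _ = (4 + 2 * C') * (M * (M:ℝ)^(1-2*δ)) := by ring
        _ ≤ (4 + 2 * C')^2 * (M * (M:ℝ)^(1-2*δ)) := by
            gcongr
            nlinarith
        _ = _ := by rw [mul_pow, e3]
    exact le_of_sq_le_sq e4 (by positivity)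

lemma oblock (c : ℝ) (hc : 1 < c) (hci : ∀ m : ℤ, (m : ℝ) ≠ c) : ∃ δ C : ℝ, ∃ M0 : ℕ, 0 < δ ∧ 0 ≤ C ∧
    ∀ M N : ℕ, M0 ≤ M → N ≤ M → ‖∑ n ∈ range N, oee (((M:ℝ) + n)^c)‖ ≤ C * (M:ℝ)^(1-δ) := by
  set k := ⌊c⌋₊ with hk
  have hk1 : (k:ℝ) ≤ c := Nat.floor_le (by linarith)
  have hk2 : c < k + 1 := Nat.lt_floor_add_one c
  have hk3 : (k:ℝ) < c := lt_of_le_of_ne hk1 (by exact_mod_cast hci (k:ℤ))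
  set s := (k:ℝ) + 1 - c with hs
  have hs0 : 0 < s := by linarith
  have hs1 : s < 1 := by linarith
  set P : ℕ → ℝ := fun j => ∏ i ∈ range j, (c - i) with hP
  set G : ℕ → ℝ → ℝ := fun j x => P j * x^(c - j) with hG
  have hGd : ∀ j x, 0 < x → HasDerivAt (G j) (G (j+1) x) x := by
    intro j x hx
    have := (Real.hasDerivAt_rpow_const (x := x) (p := c - j) (Or.inl hx.ne')).const_mul (P j)
    refine HasDerivAt.congr_deriv this ?_
    simp only [hG, hP, prod_range_succ]
    push_cast
    rw [show c - (j + 1 : ℝ) = c - j - 1 by ring]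
    ring
  have hPp : 0 < P (k+1) := by
    apply prod_pos
    intro i hi
    have : i ≤ k := by simp at hi; omega
    have : (i:ℝ) ≤ k := by exact_mod_cast this
    linarith
  have hGk : ∀ x, G (k+1) x = P (k+1) * x^(-s) := by
    intro x
    simp only [hG, hs]; push_cast; congr 2; ring
  have hanti : AntitoneOn (G (k+1)) (Set.Ioi 0) := by
    intro x hx y hy hxy
    rw [hGk, hGk]
    have := Real.rpow_le_rpow_of_nonpos hx hxy (by linarith : -s ≤ 0)
    gcongr
  obtain ⟨δ, C, M0, hδ, hC, h⟩ := oclaim k ((1+s)/2) (s/2) (by linarith) (by linarith) (by linarith)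
  have ht : ∀ e : ℝ, 0 < e → Tendsto (fun M : ℕ => (M:ℝ)^e) atTop atTop := fun e he =>
    (tendsto_rpow_atTop he).comp tendsto_natCast_atTop_atTop
  have hev := ((ht ((1-s)/2) (by linarith)).eventually_ge_atTop (2^s / P (k+1))).and
    ((ht (s/2) (by linarith)).eventually_ge_atTop (P (k+1)))
  obtain ⟨M1, hM1⟩ := eventually_atTop.1 hev
  refine ⟨δ, C, M0 + M1 + 1, hδ, hC, ?_⟩
  intro M N hM hN
  obtain ⟨q1, q2⟩ := hM1 M (by omega)
  have hMp : (0:ℝ) < M := by exact_mod_cast (by omega : 0 < M)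
  have hNM : (N:ℝ) ≤ M := by exact_mod_cast hN
  have hgood := ogood_of_family (k+1) G M N ((M:ℝ)^(-((1+s)/2))) ((M:ℝ)^(-(s/2))) hMp hGd hanti (by
    intro x hx
    have hx0 : 0 < x := hMp.trans_le hx.1
    rw [hGk]
    constructor
    · have a : (2 * (M:ℝ))^(-s) ≤ x^(-s) :=
        Real.rpow_le_rpow_of_nonpos hx0 (by linarith [hx.2]) (by linarith)
      have b : (M:ℝ)^(-((1+s)/2)) * (M:ℝ)^((1-s)/2) = (M:ℝ)^(-s) := by
        rw [← Real.rpow_add hMp]; congr 1; ring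
      have b2 : (2:ℝ)^s * (2 * (M:ℝ))^(-s) = (M:ℝ)^(-s) := by
        rw [Real.mul_rpow (by norm_num) hMp.le, ← mul_assoc, ← Real.rpow_add (by norm_num)]; simp
      rw [div_le_iff₀ hPp] at q1
      have h2 : (0:ℝ) < 2^s := by positivity
      have b3 : (2:ℝ)^s * (M:ℝ)^(-((1+s)/2)) ≤ 2^s * (P (k+1) * (2 * (M:ℝ))^(-s)) := by
        calc _ ≤ ((M:ℝ)^((1-s)/2) * P (k+1)) * (M:ℝ)^(-((1+s)/2)) := by gcongr
          _ = P (k+1) * (M:ℝ)^(-s) := by rw [← b]; ring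
          _ = _ := by rw [← b2]; ring
      have b4 := le_of_mul_le_mul_left b3 h2
      exact b4.trans (by gcongr)
    · have a : x^(-s) ≤ (M:ℝ)^(-s) :=
        Real.rpow_le_rpow_of_nonpos hMp hx.1 (by linarith)
      calc _ ≤ (M:ℝ)^(s/2) * (M:ℝ)^(-s) := by gcongr
        _ = _ := by rw [← Real.rpow_add hMp]; congr 1; ring)
  have := h M N (by omega) hN _ hgood
  simpa [hG, hP] using this

lemma opartial (c : ℝ) (hc : 1 < c) (hci : ∀ m : ℤ, (m : ℝ) ≠ c) : ∃ r K : ℝ, 0 < r ∧ r < 1 ∧ 0 ≤ K ∧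
    ∀ N : ℕ, ‖∑ n ∈ range N, oee (((n:ℝ) + 1)^c)‖ ≤ K * (N:ℝ)^r := by
  obtain ⟨δ, C, M0, hδ, hC, h⟩ := oblock c hc hci
  set r := 1 - min δ (1/2) with hr
  have hr0 : 0 < r := by have : min δ (1/2) ≤ 1/2 := min_le_right _ _; linarith
  have hr1 : r < 1 := by have : 0 < min δ (1/2) := lt_min hδ (by norm_num); linarith
  have hrδ : 1 - δ ≤ r := by have : min δ (1/2) ≤ δ := min_le_left _ _; linarith
  set q : ℝ := (1/2)^r with hq
  have hq1 : q < 1 := Real.rpow_lt_one (by norm_num) (by norm_num) hr0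
  have hq0 : 0 < 1 - q := by linarith
  set K := 2 * (M0:ℝ) + C / (1 - q) with hK
  have hK0 : 0 ≤ K := by positivity
  have hKq : C ≤ K * (1 - q) := by
    have : C / (1-q) * (1-q) = C := by field_simp
    have : 0 ≤ 2 * (M0:ℝ) * (1-q) := by positivity
    rw [hK, add_mul]; linarith
  refine ⟨r, K, hr0, hr1, hK0, ?_⟩
  intro N
  induction N using Nat.strong_induction_on with
  | _ N ih =>
  rcases Nat.eq_zero_or_pos N with h0 | hpos
  · subst h0; simp; positivity
  have hN1 : (1:ℝ) ≤ N := by exact_mod_cast hpos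
  have hNr : (1:ℝ) ≤ (N:ℝ)^r := Real.one_le_rpow hN1 hr0.le
  rcases lt_or_ge N (2 * M0) with hlt | hge
  · have a : ‖∑ n ∈ range N, oee (((n:ℝ) + 1)^c)‖ ≤ N := by
      refine (norm_sum_le _ _).trans ?_
      simp [oee_norm]
    have b : (N:ℝ) ≤ 2 * M0 := by exact_mod_cast hlt.le
    have b2 : 2 * (M0:ℝ) ≤ K := by
      have : 0 ≤ C / (1-q) := by positivity
      linarith
    nlinarith
  · have hsplit : N = N/2 + (N - N/2) := by omega
    have e : ∑ n ∈ range N, oee (((n:ℝ) + 1)^c) = ∑ n ∈ range (N/2), oee (((n:ℝ) + 1)^c) +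
        ∑ n ∈ range (N - N/2), oee ((((N/2+1 : ℕ):ℝ) + n)^c) := by
      conv_lhs => rw [hsplit]
      rw [sum_range_add]
      congr 1
      apply sum_congr rfl
      intro n _
      congr 2
      push_cast
      ring
    have h1 := ih (N/2) (by omega)
    have h2 := h (N/2+1) (N - N/2) (by omega) (by omega)
    have h3 : (((N/2+1 : ℕ):ℝ))^(1-δ) ≤ (N:ℝ)^r := by
      calc (((N/2+1 : ℕ):ℝ))^(1-δ) ≤ (((N/2+1 : ℕ):ℝ))^r :=
            Real.rpow_le_rpow_of_exponent_le (by exact_mod_cast (by omega : 1 ≤ N/2+1)) hrδ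
        _ ≤ _ := Real.rpow_le_rpow (by positivity) (by exact_mod_cast (by omega : N/2+1 ≤ N)) hr0.le
    have h4 : (((N/2 : ℕ):ℝ))^r ≤ q * (N:ℝ)^r := by
      rw [hq, ← Real.mul_rpow (by norm_num) (by positivity)]
      apply Real.rpow_le_rpow (by positivity) _ hr0.le
      have : ((N/2 : ℕ):ℝ) ≤ (N:ℝ)/2 := Nat.cast_div_le
      linarith
    rw [e]
    calc _ ≤ _ := norm_add_le _ _
      _ ≤ K * (q * (N:ℝ)^r) + C * (N:ℝ)^r := by
          refine add_le_add (h1.trans (by gcongr)) (h2.trans (by gcongr))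
      _ ≤ K * (q * (N:ℝ)^r) + (K * (1 - q)) * (N:ℝ)^r := by gcongr
      _ = _ := by ring

/-- For a non-integer `c > 1` and `p(t) = t^c`, the series `∑ e(p(n))/n` converges. -/
theorem oscillatory_series_converges (c : ℝ) (hc : 1 < c) (hci : ∀ m : ℤ, (m : ℝ) ≠ c) :
    ∃ L : ℂ, Tendsto
      (fun N : ℕ => ∑ n ∈ Finset.Icc 1 N,
        Complex.exp (2 * Real.pi * Complex.I * ((n : ℝ) ^ c : ℝ)) / (n : ℂ))
      atTop (nhds L) := by
  obtain ⟨r, K, hr0, hr1, hK, hS⟩ := opartial c hc hci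
  set S : ℕ → ℂ := fun N => ∑ n ∈ range N, oee (((n:ℝ) + 1)^c) with hSdef
  have hid : ∀ N : ℕ, ∑ n ∈ Finset.Icc 1 N,
        Complex.exp (2 * Real.pi * Complex.I * ((n : ℝ) ^ c : ℝ)) / (n : ℂ) =
      S N / ((N:ℂ) + 1) + ∑ n ∈ range N, S (n+1) / (((n:ℂ)+1) * ((n:ℂ)+2)) := by
    intro N
    induction N with
    | zero => simp [hSdef]
    | succ N ih =>
      rw [sum_Icc_succ_top (by omega), ih, sum_range_succ]
      have e : S (N+1) = S N + Complex.exp (2 * Real.pi * Complex.I * (((N+1:ℕ) : ℝ) ^ c : ℝ)) := by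
        simp only [hSdef, sum_range_succ, oee]
        push_cast
        rfl
      have n1 : (N:ℂ) + 1 ≠ 0 := by exact_mod_cast Nat.succ_ne_zero N
      have n2 : (N:ℂ) + 2 ≠ 0 := by exact_mod_cast Nat.succ_ne_zero (N+1)
      have e' := eq_sub_of_add_eq' e.symm
      rw [e']
      push_cast
      rw [show (N:ℂ) + 1 + 1 = N + 2 by ring]
      field_simp
      ring
  simp only [hid]
  have hsum : Summable (fun n : ℕ => S (n+1) / (((n:ℂ)+1) * ((n:ℂ)+2))) := by
    have hs0 : Summable (fun n : ℕ => K * (((n+1:ℕ):ℝ))^(r-2)) :=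
      ((summable_nat_add_iff 1).2 (Real.summable_nat_rpow.2 (by linarith : r - 2 < -1))).mul_left K
    refine Summable.of_norm_bounded hs0 ?_
    intro n
    have hp : (0:ℝ) < ((n+1:ℕ):ℝ) := by positivity
    have e1 : ‖((n:ℂ)+1) * ((n:ℂ)+2)‖ = ((n:ℝ)+1) * ((n:ℝ)+2) := by
      have : ((n:ℂ)+1) * ((n:ℂ)+2) = (((((n:ℝ)+1) * ((n:ℝ)+2)) : ℝ) : ℂ) := by push_cast; rfl
      rw [this, Complex.norm_real, Real.norm_of_nonneg (by positivity)]
    rw [norm_div, e1, Real.rpow_sub hp, Real.rpow_two, ← mul_div_assoc]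
    apply div_le_div₀ (by positivity) (hS (n+1)) (by positivity)
    push_cast
    nlinarith
  have hz : Tendsto (fun N : ℕ => S N / ((N:ℂ) + 1)) atTop (nhds 0) := by
    have ht : Tendsto (fun N : ℕ => K * (N:ℝ)^(-(1-r))) atTop (nhds 0) := by
      simpa using ((tendsto_rpow_neg_atTop (by linarith : 0 < 1 - r)).comp tendsto_natCast_atTop_atTop).const_mul K
    refine squeeze_zero_norm' ?_ ht
    filter_upwards [eventually_ge_atTop 1] with N hN
    have hp : (0:ℝ) < N := by exact_mod_cast hN
    have e1 : ‖(N:ℂ) + 1‖ = (N:ℝ) + 1 := by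
      have : (N:ℂ) + 1 = (((N:ℝ) + 1 : ℝ) : ℂ) := by push_cast; rfl
      rw [this, Complex.norm_real, Real.norm_of_nonneg (by positivity)]
    rw [norm_div, e1, neg_sub, Real.rpow_sub hp, Real.rpow_one, ← mul_div_assoc]
    exact div_le_div₀ (by positivity) (hS N) hp (by linarith)
  exact ⟨_, hz.add hsum.hasSum.tendsto_sum_nat⟩
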